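/- Let Q = (S, Σ, q) be an OMQ where Σ is a finite set of full tgds (no existentially quantified variables) and q a CQ, and suppose Q is a 0-1 query, i.e., Q(D) = Q(D_{01}) for every S-database D, where D_{01} is the restriction of D to facts all of whose arguments are in {0,1}. Then one can construct in polynomial time a 0-1 query Q' = (S, Σ', q') where Σ' is a sticky (indeed lossless: every body variable occurs in the head) finite set of tgds and q' a CQ, such that Q ≡ Q', i.e., Q(D) = Q'(D) for every S-database D. -/

import Mathlib

/-! Core formalization: relational instances, conjunctive queries,
tuple-generating dependencies (tgds) and ontology-mediated queries (OMQs). -/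

/-- A schema: a list of (predicate name, arity) pairs. -/
abbrev RSig : Type := List (ℕ × ℕ)

/-- Terms populating instances: constants (`Sum.inl`) or labeled nulls (`Sum.inr`). -/
abbrev GTerm : Type := ℕ ⊕ ℕ

/-- Terms of queries and tgds: constants (`Sum.inl`) or variables (`Sum.inr`). -/
abbrev QTerm : Type := ℕ ⊕ ℕ

/-- A relational atom over terms of type `T`: a predicate name and a tuple of terms. -/
abbrev RAtom (T : Type) : Type := ℕ × List T

/-- A fact: an atom whose arguments are constants. -/
abbrev DBFact : Type := RAtom ℕ

/-- A database: a finite list of facts. -/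
abbrev Database : Type := List DBFact

/-- An instance with domain `α`. -/
abbrev GInst (α : Type) : Type := Set (RAtom α)

/-- An instance over constants and labeled nulls. -/
abbrev Inst : Type := GInst GTerm

def factAtom (f : DBFact) : RAtom GTerm := (f.1, f.2.map Sum.inl)

/-- The instance corresponding to a database. -/
def dbInst (D : Database) : Inst := {a | ∃ f ∈ D, factAtom f = a}

def atomOverSig {T : Type} (S : RSig) (a : RAtom T) : Prop := (a.1, a.2.length) ∈ S

/-- `D` is a database over the schema `S`. -/
def DBover (S : RSig) (D : Database) : Prop := ∀ f ∈ D, atomOverSig S f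

/-- `I` is an instance over the schema `S`. -/
def InstOver (S : RSig) (I : Inst) : Prop := ∀ a ∈ I, atomOverSig S a

/-- Active domain of a database. -/
def adomD (D : Database) : Set ℕ := {c | ∃ f ∈ D, c ∈ f.2}

/-- Active domain of an instance. -/
def instAdom {α : Type} (I : GInst α) : Set α := {s | ∃ a ∈ I, s ∈ a.2}

/-- `c` is a tuple from `adom(D)^n`. -/
def TupleIn (D : Database) (n : ℕ) (c : List ℕ) : Prop :=
  c.length = n ∧ ∀ x ∈ c, x ∈ adomD D

/-- Variable assignments into the domain of instances. -/
abbrev Assign : Type := ℕ → GTerm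

def applyT (ν : Assign) : QTerm → GTerm := Sum.elim Sum.inl ν

def applyA (ν : Assign) (a : RAtom QTerm) : RAtom GTerm := (a.1, a.2.map (applyT ν))

/-- A tgd, given as a pair (body, head) of lists of atoms. -/
abbrev TGD : Type := List (RAtom QTerm) × List (RAtom QTerm)

/-- Variables occurring in a list of atoms. -/
def varsOf (as : List (RAtom QTerm)) : Set ℕ := {v | ∃ a ∈ as, (Sum.inr v : QTerm) ∈ a.2}

/-- Satisfaction of a tgd by an instance: every homomorphic image of the body
extends to a homomorphic image of the head (variables not occurring in the body
are existentially quantified). -/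
def satTGD (I : Inst) (τ : TGD) : Prop :=
  ∀ ν : Assign, (∀ a ∈ τ.1, applyA ν a ∈ I) →
    ∃ ν' : Assign, (∀ v ∈ varsOf τ.1, ν' v = ν v) ∧ ∀ a ∈ τ.2, applyA ν' a ∈ I

def satAll (I : Inst) (Sg : List TGD) : Prop := ∀ τ ∈ Sg, satTGD I τ

/-- A fact tgd: a tgd with empty body. -/
def IsFactTGD (τ : TGD) : Prop := τ.1 = []

/-- A class of (finite sets of) tgds closed under fact tgd extension. -/
def FactClosed (C : Set (List TGD)) : Prop :=
  ∀ Sg ∈ C, ∀ F : List TGD, (∀ τ ∈ F, IsFactTGD τ) → (Sg ++ F) ∈ C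

/-- A conjunctive query: (list of free variables, body atoms). -/
abbrev CQ : Type := List ℕ × List (RAtom QTerm)

/-- A union of conjunctive queries. -/
abbrev UCQ : Type := List CQ

/-- Evaluation of a CQ over an instance: the set of answer tuples of constants. -/
def evalCQ (q : CQ) (I : Inst) : Set (List ℕ) :=
  {c | ∃ ν : Assign, (∀ a ∈ q.2, applyA ν a ∈ I) ∧ q.1.map ν = c.map Sum.inl}

def evalUCQ (u : UCQ) (I : Inst) : Set (List ℕ) := {c | ∃ q ∈ u, c ∈ evalCQ q I}

/-- The predicates (with their arities) occurring in a finite set of tgds. -/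
def schList (Sg : List TGD) : RSig :=
  Sg.flatMap (fun τ => (τ.1 ++ τ.2).map (fun a => (a.1, a.2.length)))

/-- Certain answers of a CQ w.r.t. an instance and a set of tgds. -/
def certAnsI (Sg : List TGD) (q : CQ) (I : Inst) : Set (List ℕ) :=
  {c | ∀ J : Inst, I ⊆ J → satAll J Sg → c ∈ evalCQ q J}

/-- Certain answers of a CQ w.r.t. a database and a set of tgds. -/
def certAns (Sg : List TGD) (q : CQ) (D : Database) : Set (List ℕ) :=
  certAnsI Sg q (dbInst D)

/-- Certain answers of a UCQ w.r.t. a database and a set of tgds. -/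
def certAnsU (Sg : List TGD) (u : UCQ) (D : Database) : Set (List ℕ) :=
  {c | ∀ J : Inst, dbInst D ⊆ J → satAll J Sg → c ∈ evalUCQ u J}

/-- An ontology-mediated query: (data schema, set of tgds, CQ). -/
abbrev OMQ : Type := RSig × List TGD × CQ

/-- Evaluation of an OMQ over a database: the certain answers. -/
def omqEval (Q : OMQ) (D : Database) : Set (List ℕ) := certAns Q.2.1 Q.2.2 D

/-- Containment of two OMQs over the common data schema of `Q1`. -/
def omqContained (Q1 Q2 : OMQ) : Prop :=
  ∀ D : Database, DBover Q1.1 D → omqEval Q1 D ⊆ omqEval Q2 D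

/-- A tgd is guarded if some body atom contains all body variables. -/
def GuardedTGD (τ : TGD) : Prop :=
  ∃ g ∈ τ.1, ∀ v ∈ varsOf τ.1, (Sum.inr v : QTerm) ∈ g.2

/-- A tgd is linear if its body consists of a single atom. -/
def LinearTGD (τ : TGD) : Prop := τ.1.length = 1

/-- Edge of the predicate graph of a set of tgds. -/
def predEdge (Sg : List TGD) (R P : ℕ) : Prop :=
  ∃ τ ∈ Sg, (∃ a ∈ τ.1, a.1 = R) ∧ (∃ b ∈ τ.2, b.1 = P)

/-- A finite set of tgds is non-recursive if its predicate graph is acyclic. -/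
def NonRecursive (Sg : List TGD) : Prop :=
  ∀ R : ℕ, ¬ Relation.TransGen (predEdge Sg) R R

/-- The inductive variable-marking procedure of Calì, Gottlob and Pieris:
`Marked Sg σ x` says that the body variable `x` of `σ` is marked in `Sg`. -/
inductive Marked (Sg : List TGD) : TGD → ℕ → Prop where
  | base (σ : TGD) (x : ℕ) (hσ : σ ∈ Sg) (hx : x ∈ varsOf σ.1)
      (α : RAtom QTerm) (hα : α ∈ σ.2) (hnx : (Sum.inr x : QTerm) ∉ α.2) :
      Marked Sg σ x
  | prop (σ : TGD) (x : ℕ) (hσ : σ ∈ Sg) (hx : x ∈ varsOf σ.1)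
      (α : RAtom QTerm) (hα : α ∈ σ.2) (hxα : (Sum.inr x : QTerm) ∈ α.2)
      (σ' : TGD) (hσ' : σ' ∈ Sg) (β : RAtom QTerm) (hβ : β ∈ σ'.1)
      (hpred : β.1 = α.1) (hlen : β.2.length = α.2.length)
      (hmk : ∀ i y : ℕ, α.2[i]? = some (Sum.inr x) →
        β.2[i]? = some (Sum.inr y) → Marked Sg σ' y) :
      Marked Sg σ x

/-- A finite set of tgds is sticky if no tgd contains two occurrences
(in its body) of a marked variable. -/
def Sticky (Sg : List TGD) : Prop :=
  ∀ σ ∈ Sg, ∀ x : ℕ, Marked Sg σ x →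
    (σ.1.map (fun a => a.2.count (Sum.inr x : QTerm))).sum ≤ 1

/-- Size (number of symbols) of an atom. -/
def atomSize {T : Type} (a : RAtom T) : ℕ := 1 + a.2.length

def tgdSize (τ : TGD) : ℕ := 1 + ((τ.1 ++ τ.2).map atomSize).sum

def cqSize (q : CQ) : ℕ := 1 + q.1.length + (q.2.map atomSize).sum

/-- Number of symbols occurring in a finite set of tgds. -/
def sgSize (Sg : List TGD) : ℕ := (Sg.map tgdSize).sum

def omqSize (Q : OMQ) : ℕ := Q.1.length + sgSize Q.2.1 + cqSize Q.2.2

/-- A full tgd: no existentially quantified variables (every head variable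
occurs in the body). -/
def FullTGD (τ : TGD) : Prop := ∀ v ∈ varsOf τ.2, v ∈ varsOf τ.1

/-- A lossless tgd: every body variable occurs in the head. -/
def LosslessTGD (τ : TGD) : Prop := ∀ v ∈ varsOf τ.1, v ∈ varsOf τ.2

/-- The restriction of a database to its facts with all arguments in `{0,1}`. -/
def db01 (D : Database) : Database :=
  D.filter (fun f => f.2.all (fun c => c == 0 || c == 1))

/-- `Q` is a 0-1 query: its evaluation only depends on the restriction of the
database to the binary domain `{0,1}`. -/
def ZeroOne (Q : OMQ) : Prop :=
  ∀ D : Database, DBover Q.1 D → omqEval Q D = omqEval Q (db01 D)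

/-! ### The translation -/

namespace LosslessOMQ

/-- All atoms of a finite set of tgds. -/
def atomsOf (Sg : List TGD) : List (RAtom QTerm) := Sg.flatMap fun τ => τ.1 ++ τ.2

/-- All term occurrences in a list of atoms. -/
def termsOf (as : List (RAtom QTerm)) : List QTerm := as.flatMap Prod.snd

/-- A list of constants containing `0`, `1` and the constants of `Sg`. -/
def constList (Sg : List TGD) : List ℕ :=
  0 :: 1 :: (termsOf (atomsOf Sg)).map (Sum.elim id fun _ => 0)

/-- A predicate name larger than all the names of `Q`. -/
def freshName (Q : OMQ) : ℕ :=
  (Q.1.map Prod.fst ++ (atomsOf Q.2.1 ++ Q.2.2.2).map Prod.fst).sum + 1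

/-- The atom obtained from `P(l)`, with `P` of name `p` and arity `n`, by prefixing the constants
`C`; the tuple `l` may be longer than `n`. -/
def tagAtom (N : ℕ) (C : List ℕ) (p n : ℕ) (l : List QTerm) : RAtom QTerm :=
  (N + 1 + Nat.pair p n, C.map Sum.inl ++ l)

/-- The atom listing all the constants. -/
def constAtom (N : ℕ) (C : List ℕ) : RAtom QTerm := (N, C.map Sum.inl)

/-- Replaces constants by variables, injectively on terms. -/
def encT : QTerm → QTerm := Sum.elim (fun c => Sum.inr (2 * c)) fun v => Sum.inr (2 * v + 1)

def encA (a : RAtom QTerm) : RAtom QTerm := (a.1, a.2.map encT)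

def encRule (τ : TGD) : TGD := (τ.1.map encA, τ.2.map encA)

/-- The tuple of the first `n` variables. -/
def varTuple (n : ℕ) : List QTerm := (List.range n).map Sum.inr

def constRule (N : ℕ) (C : List ℕ) : TGD := ([], [constAtom N C])

def copyRule (N : ℕ) (C : List ℕ) (a : RAtom QTerm) : TGD :=
  ([(a.1, varTuple a.2.length)], [tagAtom N C a.1 a.2.length (varTuple a.2.length)])

def tagOf (N : ℕ) (C : List ℕ) (a : RAtom QTerm) : RAtom QTerm :=
  tagAtom N C a.1 a.2.length a.2

/-- The lossless version of the rule `b → h`: all terms of the body are appended to the head. -/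
def mainRule (N : ℕ) (C : List ℕ) (b : List (RAtom QTerm)) (h : RAtom QTerm) : TGD :=
  (constAtom N C :: b.map (tagOf N C), [tagAtom N C h.1 h.2.length (h.2 ++ termsOf b)])

/-- Drops the last argument if it is the constant `c`. -/
def dropRule (N : ℕ) (C : List ℕ) (a : RAtom QTerm) (k c : ℕ) : TGD :=
  ([tagAtom N C a.1 a.2.length (varTuple (a.2.length + k) ++ [Sum.inl c])],
    [tagAtom N C a.1 a.2.length (varTuple (a.2.length + k))])

def rules (N : ℕ) (Sg : List TGD) (q : CQ) : List TGD :=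
  [constRule N (constList Sg)] ++
  (atomsOf Sg ++ q.2).map (copyRule N (constList Sg)) ++
  (Sg.flatMap fun τ => τ.2.map fun h => encRule (mainRule N (constList Sg) τ.1 h)) ++
  (atomsOf Sg).flatMap fun a => (List.range (termsOf (atomsOf Sg)).length).flatMap fun k =>
    (constList Sg).map fun c => encRule (dropRule N (constList Sg) a k c)

def translate (Q : OMQ) : OMQ :=
  (Q.1, rules (freshName Q) Q.2.1 Q.2.2,
    (Q.2.2.1, Q.2.2.2.map (tagOf (freshName Q) (constList Q.2.1))))

/-! ### Computability -/

section Computability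

open Primrec

variable {α : Type*} [Primcodable α]

theorem primrec_termsOf : Primrec termsOf := list_flatMap .id (snd.comp snd).to₂

theorem primrec_atomsOf : Primrec atomsOf :=
  list_flatMap .id (list_append.comp (fst.comp snd) (snd.comp snd)).to₂

theorem primrec_constList : Primrec constList := by
  have h : Primrec fun t : QTerm => (Sum.elim id (fun _ => 0) t : ℕ) :=
    (sumCasesOn .id snd.to₂ (Primrec.const 0).to₂).of_eq fun t => by cases t <;> rfl
  exact list_cons.comp (.const 0) (list_cons.comp (.const 1)
    (list_map (primrec_termsOf.comp primrec_atomsOf) (h.comp snd).to₂))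

theorem primrec_sum : Primrec (List.sum : List ℕ → ℕ) :=
  (list_foldr .id (.const 0) (nat_add.comp (fst.comp snd) (snd.comp snd)).to₂).of_eq
    fun l => by rfl

theorem primrec_freshName : Primrec freshName :=
  succ.comp <| primrec_sum.comp <| list_append.comp (list_map fst (fst.comp snd).to₂) <|
    list_map (list_append.comp (primrec_atomsOf.comp (fst.comp snd)) (snd.comp (snd.comp snd)))
      (fst.comp snd).to₂

theorem primrec_mapInl : Primrec fun C : List ℕ => (C.map Sum.inl : List QTerm) :=
  list_map .id (sumInl.comp snd).to₂

theorem primrec_tagAtom {N p n : α → ℕ} {C : α → List ℕ} {l : α → List QTerm}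
    (hN : Primrec N) (hC : Primrec C) (hp : Primrec p) (hn : Primrec n) (hl : Primrec l) :
    Primrec fun x => tagAtom (N x) (C x) (p x) (n x) (l x) :=
  .pair (nat_add.comp (succ.comp hN) (Primrec₂.natPair.comp hp hn))
    (list_append.comp (primrec_mapInl.comp hC) hl)

theorem primrec_tagOf {N : α → ℕ} {C : α → List ℕ} {a : α → RAtom QTerm}
    (hN : Primrec N) (hC : Primrec C) (ha : Primrec a) :
    Primrec fun x => tagOf (N x) (C x) (a x) :=
  primrec_tagAtom hN hC (fst.comp ha) (list_length.comp (snd.comp ha)) (snd.comp ha)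

theorem primrec_constAtom {N : α → ℕ} {C : α → List ℕ} (hN : Primrec N) (hC : Primrec C) :
    Primrec fun x => constAtom (N x) (C x) :=
  .pair hN (primrec_mapInl.comp hC)

theorem primrec_encT : Primrec encT :=
  (sumCasesOn .id (sumInr.comp (nat_mul.comp (.const 2) snd)).to₂
    (sumInr.comp (succ.comp (nat_mul.comp (.const 2) snd))).to₂).of_eq fun t => by
      cases t <;> rfl

theorem primrec_encA : Primrec encA :=
  .pair fst (list_map snd (primrec_encT.comp snd).to₂)

theorem primrec_encRule : Primrec encRule :=
  .pair (list_map fst (primrec_encA.comp snd).to₂) (list_map snd (primrec_encA.comp snd).to₂)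

theorem primrec_varTuple : Primrec varTuple := list_map list_range (sumInr.comp snd).to₂

theorem primrec_singleton {β : Type*} [Primcodable β] : Primrec fun b : β => [b] :=
  list_cons.comp .id (.const [])

theorem primrec_copyRule {N : α → ℕ} {C : α → List ℕ} {a : α → RAtom QTerm}
    (hN : Primrec N) (hC : Primrec C) (ha : Primrec a) :
    Primrec fun x => copyRule (N x) (C x) (a x) :=
  have hn := list_length.comp (snd.comp ha)
  .pair (primrec_singleton.comp (.pair (fst.comp ha) (primrec_varTuple.comp hn)))
    (primrec_singleton.comp
      (primrec_tagAtom hN hC (fst.comp ha) hn (primrec_varTuple.comp hn)))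

theorem primrec_mainRule {N : α → ℕ} {C : α → List ℕ} {b : α → List (RAtom QTerm)}
    {h : α → RAtom QTerm} (hN : Primrec N) (hC : Primrec C) (hb : Primrec b) (hh : Primrec h) :
    Primrec fun x => mainRule (N x) (C x) (b x) (h x) :=
  .pair (list_cons.comp (primrec_constAtom hN hC)
      (list_map hb (primrec_tagOf (hN.comp fst) (hC.comp fst) snd).to₂))
    (primrec_singleton.comp (primrec_tagAtom hN hC (fst.comp hh)
      (list_length.comp (snd.comp hh))
      (list_append.comp (snd.comp hh) (primrec_termsOf.comp hb))))

theorem primrec_dropRule {N k c : α → ℕ} {C : α → List ℕ} {a : α → RAtom QTerm}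
    (hN : Primrec N) (hC : Primrec C) (ha : Primrec a) (hk : Primrec k) (hc : Primrec c) :
    Primrec fun x => dropRule (N x) (C x) (a x) (k x) (c x) :=
  have hn := list_length.comp (snd.comp ha)
  have hv := primrec_varTuple.comp (nat_add.comp hn hk)
  .pair (primrec_singleton.comp (primrec_tagAtom hN hC (fst.comp ha) hn
      (list_append.comp hv (primrec_singleton.comp (sumInl.comp hc)))))
    (primrec_singleton.comp (primrec_tagAtom hN hC (fst.comp ha) hn hv))

theorem primrec_rules {N : α → ℕ} {Sg : α → List TGD} {q : α → CQ}
    (hN : Primrec N) (hS : Primrec Sg) (hq : Primrec q) :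
    Primrec fun x => rules (N x) (Sg x) (q x) := by
  have hC := primrec_constList.comp hS
  have hA := primrec_atomsOf.comp hS
  refine list_append.comp (list_append.comp (list_append.comp ?_ ?_) ?_) ?_
  · exact primrec_singleton.comp (.pair (.const [])
      (primrec_singleton.comp (primrec_constAtom hN hC)))
  · exact list_map (list_append.comp hA (snd.comp hq))
      (primrec_copyRule (hN.comp fst) (hC.comp fst) snd).to₂
  · have hm : Primrec₂ fun (x : α × TGD) (h : RAtom QTerm) =>
        encRule (mainRule (N x.1) (constList (Sg x.1)) x.2.1 h) :=
      (primrec_encRule.comp (primrec_mainRule (hN.comp (fst.comp fst))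
        (hC.comp (fst.comp fst)) (fst.comp (snd.comp fst)) snd)).to₂
    exact list_flatMap hS (list_map (snd.comp snd) hm).to₂
  · have hd : Primrec₂ fun (x : (α × RAtom QTerm) × ℕ) (c : ℕ) =>
        encRule (dropRule (N x.1.1) (constList (Sg x.1.1)) x.1.2 x.2 c) :=
      (primrec_encRule.comp (primrec_dropRule (hN.comp (fst.comp (fst.comp fst)))
        (hC.comp (fst.comp (fst.comp fst))) (snd.comp (fst.comp fst)) (snd.comp fst) snd)).to₂
    have hk : Primrec₂ fun (x : α × RAtom QTerm) (k : ℕ) => (constList (Sg x.1)).map fun c =>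
        encRule (dropRule (N x.1) (constList (Sg x.1)) x.2 k c) :=
      (list_map (hC.comp (fst.comp fst)) hd).to₂
    exact list_flatMap hA (list_flatMap
      (list_range.comp (list_length.comp (primrec_termsOf.comp (hA.comp fst)))) hk).to₂

theorem primrec_translate : Primrec translate :=
  .pair fst (.pair (primrec_rules primrec_freshName (fst.comp snd) (snd.comp snd))
    (.pair (fst.comp (snd.comp snd)) (list_map (snd.comp (snd.comp snd))
      (primrec_tagOf (primrec_freshName.comp fst)
        (primrec_constList.comp (fst.comp (snd.comp fst))) snd).to₂)))

end Computability

/-! ### Output size -/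

section Size

theorem sum_atomSize (as : List (RAtom QTerm)) :
    (as.map atomSize).sum = as.length + (termsOf as).length := by
  induction as with
  | nil => rfl
  | cons a as ih => simp_all [termsOf, atomSize]; omega

theorem sgSize_eq (Sg : List TGD) :
    sgSize Sg = Sg.length + (atomsOf Sg).length + (termsOf (atomsOf Sg)).length := by
  induction Sg with
  | nil => rfl
  | cons τ Sg ih =>
    have h := sum_atomSize (τ.1 ++ τ.2)
    simp_all [sgSize, tgdSize, atomsOf, termsOf]
    omega

theorem tgdSize_encRule (τ : TGD) : tgdSize (encRule τ) = tgdSize τ := by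
  have : atomSize ∘ encA = atomSize := by ext a; simp [encA, atomSize]
  simp [tgdSize, encRule, this]

theorem atomSize_tagAtom (N : ℕ) (C : List ℕ) (p n : ℕ) (l : List QTerm) :
    atomSize (tagAtom N C p n l) = 1 + C.length + l.length := by
  simp [atomSize, tagAtom]; omega

theorem sum_atomSize_tagOf (N : ℕ) (C : List ℕ) (as : List (RAtom QTerm)) :
    ((as.map (tagOf N C)).map atomSize).sum
      = as.length * (1 + C.length) + (termsOf as).length := by
  induction as with
  | nil => simp [termsOf]
  | cons a as ih =>
    simp only [List.map_cons, List.sum_cons, ih, List.length_cons, tagOf, atomSize_tagAtom]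
    simp [termsOf]
    ring

theorem length_constList (Sg : List TGD) :
    (constList Sg).length = (termsOf (atomsOf Sg)).length + 2 := by simp [constList]

theorem tgdSize_mainRule_le {N u : ℕ} {C : List ℕ} {b : List (RAtom QTerm)} {h : RAtom QTerm}
    (hC : C.length ≤ 2 * u) (hb : b.length + (termsOf b).length + h.2.length ≤ u) (hu : 1 ≤ u) :
    tgdSize (mainRule N C b h) ≤ 13 * u ^ 2 := by
  have hs := sum_atomSize_tagOf N C b
  have e : tgdSize (mainRule N C b h) = 1 + (1 + C.length) +
      (b.length * (1 + C.length) + (termsOf b).length) +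
      (1 + C.length + (h.2.length + (termsOf b).length)) := by
    simp only [tgdSize, mainRule, List.cons_append, List.map_cons, List.map_append, List.sum_cons,
      List.sum_append, hs, atomSize_tagAtom]
    simp [constAtom, atomSize]
    omega
  have hm : b.length * (1 + C.length) ≤ u * (1 + 2 * u) := Nat.mul_le_mul (by omega) (by omega)
  rw [e]
  nlinarith

theorem tgdSize_copyRule_le {N u : ℕ} {C : List ℕ} {a : RAtom QTerm}
    (hC : C.length ≤ 2 * u) (ha : a.2.length ≤ u) (hu : 1 ≤ u) :
    tgdSize (copyRule N C a) ≤ 13 * u ^ 2 := by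
  have e : tgdSize (copyRule N C a) = 3 + C.length + 2 * a.2.length := by
    simp [tgdSize, copyRule, atomSize_tagAtom]
    simp [atomSize, varTuple]
    omega
  rw [e]
  nlinarith

theorem tgdSize_dropRule_le {N u k c : ℕ} {C : List ℕ} {a : RAtom QTerm}
    (hC : C.length ≤ 2 * u) (ha : a.2.length ≤ u) (hk : k ≤ u) (hu : 1 ≤ u) :
    tgdSize (dropRule N C a k c) ≤ 13 * u ^ 2 := by
  have e : tgdSize (dropRule N C a k c) = 4 + 2 * C.length + 2 * a.2.length + 2 * k := by
    simp [tgdSize, dropRule, atomSize_tagAtom]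
    simp [varTuple]
    omega
  rw [e]
  nlinarith

theorem length_args_le_of_mem {as : List (RAtom QTerm)} {a : RAtom QTerm} (h : a ∈ as) :
    a.2.length ≤ (termsOf as).length := by
  induction as with
  | nil => simp at h
  | cons b as ih =>
    rcases List.mem_cons.1 h with rfl | h
    · simp [termsOf]
    · have := ih h
      simp_all [termsOf]
      omega

theorem length_flatMap_le {α β : Type*} (l : List α) (f : α → List β) (n : ℕ)
    (h : ∀ a ∈ l, (f a).length ≤ n) : (l.flatMap f).length ≤ l.length * n := by
  rw [List.length_flatMap]
  have := List.sum_le_card_nsmul (l.map fun a => (f a).length) n (by simpa using h)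
  simpa using this

theorem length_rules_le (N : ℕ) (Sg : List TGD) (q : CQ) :
    (rules N Sg q).length ≤ 1 + ((atomsOf Sg).length + q.2.length) + (atomsOf Sg).length +
      (atomsOf Sg).length * ((termsOf (atomsOf Sg)).length * (constList Sg).length) := by
  have h1 : (Sg.flatMap fun τ => τ.2.map fun h =>
      encRule (mainRule N (constList Sg) τ.1 h)).length ≤ (atomsOf Sg).length := by
    rw [atomsOf, List.length_flatMap, List.length_flatMap]
    exact List.sum_le_sum fun τ _ => by simp
  have h2 := length_flatMap_le (atomsOf Sg) (fun a =>
    (List.range (termsOf (atomsOf Sg)).length).flatMap fun k =>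
      (constList Sg).map fun c => encRule (dropRule N (constList Sg) a k c))
      ((termsOf (atomsOf Sg)).length * (constList Sg).length) fun a _ => by
        simp
  simp only [rules, List.length_append, List.length_map, List.length_singleton]
  omega

theorem tgdSize_le_of_mem_rules {N u : ℕ} {Sg : List TGD} {q : CQ} (hu : 1 ≤ u)
    (hS : sgSize Sg + 1 ≤ u) (hq : cqSize q ≤ u) {τ : TGD} (hτ : τ ∈ rules N Sg q) :
    tgdSize τ ≤ 13 * u ^ 2 := by
  have hC := length_constList Sg
  have hSg := sgSize_eq Sg
  have hCu : (constList Sg).length ≤ 2 * u := by omega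
  have hq' := sum_atomSize q.2
  simp only [cqSize] at hq
  simp only [rules, List.mem_append, List.mem_singleton, List.mem_map, List.mem_flatMap,
    List.mem_range] at hτ
  rcases hτ with ((rfl | ⟨a, ha, rfl⟩) | ⟨σ, hσ, h, hh, rfl⟩) | ⟨a, ha, k, hk, c, -, rfl⟩
  · have : tgdSize (constRule N (constList Sg)) = 2 + (constList Sg).length := by
      simp [tgdSize, constRule, constAtom, atomSize]; omega
    nlinarith
  · refine tgdSize_copyRule_le hCu ?_ hu
    rcases ha with ha | ha <;> have := length_args_le_of_mem ha <;> omega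
  · rw [tgdSize_encRule]
    have h1 : tgdSize σ ≤ sgSize Sg := List.le_sum_of_mem (List.mem_map_of_mem hσ)
    have h2 := length_args_le_of_mem hh
    have h3 := sum_atomSize σ.1
    have h4 := sum_atomSize σ.2
    simp only [tgdSize, List.map_append, List.sum_append] at h1
    exact tgdSize_mainRule_le hCu (by omega) hu
  · rw [tgdSize_encRule]
    have := length_args_le_of_mem ha
    exact tgdSize_dropRule_le hCu (by omega) (by omega) hu

theorem omqSize_translate_le (Q : OMQ) : omqSize (translate Q) ≤ 90 * (omqSize Q + 1) ^ 5 := by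
  obtain ⟨S, Sg, q⟩ := Q
  generalize hu : omqSize (S, Sg, q) + 1 = u
  simp only [omqSize] at hu
  have hq : 1 ≤ cqSize q := by simp only [cqSize]; omega
  have hC := length_constList Sg
  have hSg := sgSize_eq Sg
  have hcq : cqSize q = 1 + q.1.length + (q.2.length + (termsOf q.2).length) := by
    rw [← sum_atomSize]; rfl
  set N := freshName (S, Sg, q)
  have hsum := List.sum_le_card_nsmul ((rules N Sg q).map tgdSize) (13 * u ^ 2) (by
    intro n hn
    obtain ⟨τ, hτ, rfl⟩ := List.mem_map.1 hn
    exact tgdSize_le_of_mem_rules (by omega) (by omega) (by omega) hτ)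
  have hlen := length_rules_le N Sg q
  have hmul : (atomsOf Sg).length * ((termsOf (atomsOf Sg)).length * (constList Sg).length)
      ≤ u * (u * (2 * u)) :=
    Nat.mul_le_mul (by omega) (Nat.mul_le_mul (by omega) (by omega))
  have hu1 : 1 ≤ u := by omega
  have hu2 : u ≤ u ^ 2 := Nat.le_self_pow (by norm_num) u
  have hu3 : u ^ 2 ≤ u ^ 3 := Nat.pow_le_pow_right hu1 (by norm_num)
  have hu5 : u ^ 3 ≤ u ^ 5 := Nat.pow_le_pow_right hu1 (by norm_num)
  have hcount : (rules N Sg q).length ≤ 6 * u ^ 3 := by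
    have : u * (u * (2 * u)) = 2 * u ^ 3 := by ring
    omega
  have hrules : sgSize (rules N Sg q) ≤ 78 * u ^ 5 := by
    refine hsum.trans ?_
    rw [List.length_map, smul_eq_mul]
    refine (Nat.mul_le_mul_right _ hcount).trans (le_of_eq ?_)
    ring
  have hq2 : q.2.length * (1 + (constList Sg).length) ≤ u * (1 + 2 * u) :=
    Nat.mul_le_mul (by omega) (by omega)
  have hq3 : u * (1 + 2 * u) = u + 2 * u ^ 2 := by ring
  have hcq' : cqSize (q.1, q.2.map (tagOf N (constList Sg))) =
      1 + q.1.length + (q.2.length * (1 + (constList Sg).length) + (termsOf q.2).length) := by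
    rw [← sum_atomSize_tagOf N]; rfl
  change S.length + sgSize (rules N Sg q) + cqSize (q.1, q.2.map (tagOf N (constList Sg))) ≤ _
  omega

end Size

/-! ### Syntactic properties -/

/-- Bodies are free of constants and every head atom contains all body variables. -/
def StrictlyLossless (τ : TGD) : Prop :=
  τ.2 ≠ [] ∧ ∀ t ∈ termsOf τ.1, (∃ v, t = Sum.inr v) ∧ ∀ α ∈ τ.2, t ∈ α.2

theorem mem_varsOf {as : List (RAtom QTerm)} {v : ℕ} :
    v ∈ varsOf as ↔ (Sum.inr v : QTerm) ∈ termsOf as := by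
  simp [varsOf, termsOf]

theorem StrictlyLossless.lossless {τ : TGD} (h : StrictlyLossless τ) : LosslessTGD τ := by
  obtain ⟨α, hα⟩ := List.exists_mem_of_ne_nil _ h.1
  exact fun v hv => ⟨α, hα, (h.2 _ (mem_varsOf.1 hv)).2 α hα⟩

theorem not_marked {Sg : List TGD} (h : ∀ τ ∈ Sg, StrictlyLossless τ) {τ : TGD} {x : ℕ} :
    ¬ Marked Sg τ x := by
  intro hm
  induction hm with
  | base σ x hσ hx α hα hnx => exact hnx (((h σ hσ).2 _ (mem_varsOf.1 hx)).2 α hα)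
  | prop σ x hσ hx α hα hxα σ' hσ' β hβ hpred hlen hmk ih =>
    obtain ⟨i, hi, hxi⟩ := List.getElem_of_mem hxα
    have hiβ : i < β.2.length := hlen ▸ hi
    obtain ⟨y, hy⟩ := ((h σ' hσ').2 β.2[i]
      (List.mem_flatMap.2 ⟨β, hβ, List.getElem_mem hiβ⟩)).1
    exact ih i y (List.getElem?_eq_some_iff.2 ⟨hi, hxi⟩)
      (List.getElem?_eq_some_iff.2 ⟨hiβ, hy⟩)

theorem sticky_of_strictlyLossless {Sg : List TGD} (h : ∀ τ ∈ Sg, StrictlyLossless τ) :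
    Sticky Sg :=
  fun _ _ _ hm => absurd hm (not_marked h)

theorem termsOf_map_encA (as : List (RAtom QTerm)) :
    termsOf (as.map encA) = (termsOf as).map encT := by
  simp [termsOf, encA, List.flatMap_map, List.map_flatMap]

theorem strictlyLossless_encRule {τ : TGD} (h0 : τ.2 ≠ [])
    (h : ∀ t ∈ termsOf τ.1, ∀ α ∈ τ.2, t ∈ α.2) : StrictlyLossless (encRule τ) := by
  refine ⟨by simpa [encRule] using h0, fun t ht => ?_⟩
  simp only [encRule, termsOf_map_encA, List.mem_map] at ht
  obtain ⟨s, hs, rfl⟩ := ht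
  refine ⟨by cases s <;> simp [encT], fun α hα => ?_⟩
  obtain ⟨β, hβ, rfl⟩ := List.mem_map.1 hα
  exact List.mem_map_of_mem (h s hs β hβ)

theorem mem_constList_of_mem {Sg : List TGD} {c : ℕ}
    (h : (Sum.inl c : QTerm) ∈ termsOf (atomsOf Sg)) : c ∈ constList Sg :=
  List.mem_cons_of_mem _ (List.mem_cons_of_mem _ (List.mem_map.2 ⟨_, h, rfl⟩))

theorem termsOf_mainRule_body {N : ℕ} {C : List ℕ} {b : List (RAtom QTerm)} {h : RAtom QTerm}
    {t : QTerm} : t ∈ termsOf (mainRule N C b h).1 ↔ t ∈ C.map Sum.inl ∨ t ∈ termsOf b := by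
  simp only [termsOf, mainRule, constAtom, tagOf, tagAtom, List.mem_flatMap, List.mem_cons,
    List.mem_map]
  constructor
  · rintro ⟨_, rfl | ⟨a, ha, rfl⟩, ht⟩
    · exact .inl (by simpa using ht)
    · rcases List.mem_append.1 ht with ht | ht
      · exact .inl (by simpa using ht)
      · exact .inr ⟨a, ha, ht⟩
  · rintro (ht | ⟨a, ha, ht⟩)
    · exact ⟨_, .inl rfl, by simpa using ht⟩
    · exact ⟨_, .inr ⟨a, ha, rfl⟩, List.mem_append_right _ ht⟩

theorem strictlyLossless_rules (N : ℕ) (Sg : List TGD) (q : CQ) :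
    ∀ τ ∈ rules N Sg q, StrictlyLossless τ := by
  intro τ hτ
  simp only [rules, List.mem_append, List.mem_singleton, List.mem_map, List.mem_flatMap,
    List.mem_range] at hτ
  rcases hτ with ((rfl | ⟨a, -, rfl⟩) | ⟨σ, -, h, -, rfl⟩) | ⟨a, -, k, -, c, hc, rfl⟩
  · simp [StrictlyLossless, constRule, termsOf]
  · refine ⟨by simp [copyRule], fun t ht => ?_⟩
    simp only [copyRule, termsOf, List.flatMap_cons, List.flatMap_nil, List.append_nil] at ht
    refine ⟨?_, by simp [copyRule, tagAtom, ht]⟩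
    obtain ⟨i, -, rfl⟩ := List.mem_map.1 ht
    exact ⟨i, rfl⟩
  · refine strictlyLossless_encRule (by simp [mainRule]) fun t ht => ?_
    rw [termsOf_mainRule_body] at ht
    simp only [mainRule, tagAtom, List.mem_singleton, forall_eq, List.mem_append]
    tauto
  · refine strictlyLossless_encRule (by simp [dropRule]) fun t ht => ?_
    simp only [dropRule, tagAtom, termsOf, List.flatMap_cons, List.flatMap_nil, List.append_nil,
      List.mem_append, List.mem_singleton] at ht
    simp only [dropRule, tagAtom, List.mem_singleton, forall_eq, List.mem_append]
    rcases ht with ht | ht | rfl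
    · exact .inl ht
    · exact .inr ht
    · exact .inl (List.mem_map_of_mem hc)

theorem fullTGD_iff {τ : TGD} :
    FullTGD τ ↔ ∀ v, (Sum.inr v : QTerm) ∈ termsOf τ.2 → (Sum.inr v : QTerm) ∈ termsOf τ.1 := by
  simp only [FullTGD, mem_varsOf]

theorem fullTGD_encRule {τ : TGD} (h : ∀ t ∈ termsOf τ.2, t ∈ termsOf τ.1) :
    FullTGD (encRule τ) := by
  rw [fullTGD_iff]
  intro v hv
  simp only [encRule, termsOf_map_encA, List.mem_map] at hv ⊢
  obtain ⟨t, ht, e⟩ := hv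
  exact ⟨t, h t ht, e⟩

theorem mem_atomsOf {Sg : List TGD} {τ : TGD} (hτ : τ ∈ Sg) {a : RAtom QTerm}
    (ha : a ∈ τ.1 ∨ a ∈ τ.2) : a ∈ atomsOf Sg :=
  List.mem_flatMap.2 ⟨τ, hτ, List.mem_append.2 ha⟩

theorem mem_termsOf {as : List (RAtom QTerm)} {a : RAtom QTerm} (ha : a ∈ as) {t : QTerm}
    (ht : t ∈ a.2) : t ∈ termsOf as :=
  List.mem_flatMap.2 ⟨a, ha, ht⟩

theorem fullTGD_rules {N : ℕ} {Sg : List TGD} {q : CQ} (hfull : ∀ τ ∈ Sg, FullTGD τ) :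
    ∀ τ ∈ rules N Sg q, FullTGD τ := by
  intro τ hτ
  simp only [rules, List.mem_append, List.mem_singleton, List.mem_map, List.mem_flatMap,
    List.mem_range] at hτ
  rcases hτ with ((rfl | ⟨a, -, rfl⟩) | ⟨σ, hσ, h, hh, rfl⟩) | ⟨a, -, k, -, c, hc, rfl⟩
  · simp [fullTGD_iff, constRule, constAtom, termsOf]
  · simp [fullTGD_iff, copyRule, tagAtom, termsOf]
  · refine fullTGD_encRule fun t ht => ?_
    rw [termsOf_mainRule_body]
    simp only [mainRule, tagAtom, termsOf, List.flatMap_cons, List.flatMap_nil, List.append_nil,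
      List.mem_append] at ht
    rcases ht with ht | ht | ht
    · exact .inl ht
    · rcases t with c | v
      · exact .inl (List.mem_map_of_mem (mem_constList_of_mem
          (mem_termsOf (mem_atomsOf hσ (.inr hh)) ht)))
      · exact .inr (fullTGD_iff.1 (hfull σ hσ) v (mem_termsOf hh ht))
    · exact .inr ht
  · refine fullTGD_encRule fun t ht => ?_
    simp only [dropRule, tagAtom, termsOf, List.flatMap_cons, List.flatMap_nil, List.append_nil,
      List.mem_append] at ht ⊢
    tauto

/-! ### Semantics -/

theorem satTGD_of_forall {I : Inst} {τ : TGD}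
    (h : ∀ ν : Assign, (∀ a ∈ τ.1, applyA ν a ∈ I) → ∀ a ∈ τ.2, applyA ν a ∈ I) : satTGD I τ :=
  fun ν hν => ⟨ν, fun _ _ => rfl, h ν hν⟩

theorem satAll.apply_of_full {I : Inst} {Sg : List TGD} (hs : satAll I Sg)
    (hfull : ∀ τ ∈ Sg, FullTGD τ) {τ : TGD} (hτ : τ ∈ Sg) {ν : Assign}
    (hν : ∀ a ∈ τ.1, applyA ν a ∈ I) : ∀ a ∈ τ.2, applyA ν a ∈ I := by
  obtain ⟨ν', h1, h2⟩ := hs τ hτ ν hν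
  intro a ha
  convert h2 a ha using 1
  refine Prod.ext rfl (List.map_congr_left fun t ht => ?_)
  rcases t with c | v
  · rfl
  · exact (h1 v (hfull τ hτ v ⟨a, ha, ht⟩)).symm

theorem applyA_tagAtom (ν : Assign) (N : ℕ) (C : List ℕ) (p n : ℕ) (l : List QTerm) :
    applyA ν (tagAtom N C p n l) =
      (N + 1 + Nat.pair p n, C.map Sum.inl ++ l.map (applyT ν)) := by
  simp [applyA, tagAtom, applyT]

theorem applyA_encA_tagAtom (ν : Assign) (N : ℕ) (C : List ℕ) (p n : ℕ) (l : List QTerm) :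
    applyA ν (encA (tagAtom N C p n l)) =
      (N + 1 + Nat.pair p n,
        (C.map fun c => ν (2 * c)) ++ l.map fun t => applyT ν (encT t)) := by
  simp [applyA, encA, tagAtom, applyT, encT, Function.comp_def]

theorem applyA_encA_constAtom (ν : Assign) (N : ℕ) (C : List ℕ) :
    applyA ν (encA (constAtom N C)) = (N, C.map fun c => ν (2 * c)) := by
  simp [applyA, encA, constAtom, applyT, encT]

/-- The assignment behaving on encoded terms like `ν` on the original ones. -/
def encAssign (ν : Assign) : Assign := fun m => if m % 2 = 0 then Sum.inl (m / 2) else ν (m / 2)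

theorem applyT_encAssign (ν : Assign) (t : QTerm) :
    applyT (encAssign ν) (encT t) = applyT ν t := by
  rcases t with c | v
  · simp [applyT, encT, encAssign]
  · have : (2 * v + 1) / 2 = v := by omega
    simp [applyT, encT, encAssign, this]

theorem applyA_encAssign (ν : Assign) (a : RAtom QTerm) :
    applyA (encAssign ν) (encA a) = applyA ν a := by
  simp [applyA, encA, applyT_encAssign]

theorem names_lt_freshName {Q : OMQ} :
    (∀ D, DBover Q.1 D → ∀ f ∈ D, f.1 < freshName Q) ∧
      ∀ a ∈ atomsOf Q.2.1 ++ Q.2.2.2, a.1 < freshName Q := by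
  constructor
  · intro D hD f hf
    refine Nat.lt_succ_of_le (List.le_sum_of_mem (List.mem_append_left _ ?_))
    exact List.mem_map.2 ⟨_, hD f hf, rfl⟩
  · intro a ha
    exact Nat.lt_succ_of_le (List.le_sum_of_mem
      (List.mem_append_right _ (List.mem_map.2 ⟨_, ha, rfl⟩)))

theorem certAns_mono {Sg : List TGD} {q : CQ} {D D' : Database} (h : D ⊆ D') :
    certAns Sg q D ⊆ certAns Sg q D' := by
  intro c hc J hJ hs
  refine hc J (fun a ha => hJ ?_) hs
  obtain ⟨f, hf, rfl⟩ := ha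
  exact ⟨f, h hf, rfl⟩

/-! #### Soundness -/

/-- The model of the translated tgds induced by a model `J` of the original ones. -/
def liftInst (N : ℕ) (C : List ℕ) (D : Database) (J : Inst) : Inst :=
  {a | a ∈ dbInst D ∨ a = (N, C.map Sum.inl) ∨ ∃ p n l,
    a = (N + 1 + Nat.pair p n, C.map Sum.inl ++ l) ∧ n ≤ l.length ∧ (p, l.take n) ∈ J}

section Soundness

variable {N : ℕ} {C : List ℕ} {D : Database} {J : Inst}

theorem mem_liftInst_tag (hD : ∀ f ∈ D, f.1 < N) {p n : ℕ} {c l : List GTerm}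
    (hc : c.length = C.length) :
    (N + 1 + Nat.pair p n, c ++ l) ∈ liftInst N C D J ↔
      c = C.map Sum.inl ∧ n ≤ l.length ∧ (p, l.take n) ∈ J := by
  constructor
  · rintro (⟨f, hf, e⟩ | e | ⟨p', n', l', e, hn, hJ⟩)
    · have h1 := hD f hf
      have h2 : f.1 = N + 1 + Nat.pair p n := congrArg Prod.fst e
      omega
    · have h2 : N + 1 + Nat.pair p n = N := congrArg Prod.fst e
      omega
    · have h1 : N + 1 + Nat.pair p n = N + 1 + Nat.pair p' n' := congrArg Prod.fst e
      obtain ⟨rfl, rfl⟩ := Nat.pair_eq_pair.1 (Nat.add_left_cancel h1)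
      obtain ⟨rfl, rfl⟩ := List.append_inj (congrArg Prod.snd e) (by simpa using hc)
      exact ⟨rfl, hn, hJ⟩
  · rintro ⟨rfl, hn, hJ⟩
    exact .inr (.inr ⟨p, n, l, rfl, hn, hJ⟩)

theorem eq_of_mem_liftInst_const (hD : ∀ f ∈ D, f.1 < N) {c : List GTerm}
    (h : (N, c) ∈ liftInst N C D J) : c = C.map Sum.inl := by
  rcases h with ⟨f, hf, e⟩ | e | ⟨p, n, l, e, -, -⟩
  · exact absurd (congrArg Prod.fst e : f.1 = N) (hD f hf).ne
  · exact congrArg Prod.snd e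
  · have h2 : N = N + 1 + Nat.pair p n := congrArg Prod.fst e
    omega

theorem mem_dbInst_of_mem_liftInst {p : ℕ} {l : List GTerm} (hp : p < N)
    (h : (p, l) ∈ liftInst N C D J) : (p, l) ∈ dbInst D := by
  rcases h with h | e | ⟨p', n, l, e, -, -⟩
  · exact h
  · exact absurd (congrArg Prod.fst e : p = N) hp.ne
  · have h2 : p = N + 1 + Nat.pair p' n := congrArg Prod.fst e
    omega

theorem satAll_liftInst {Sg : List TGD} {q : CQ} (hD : ∀ f ∈ D, f.1 < N)
    (hN : ∀ a ∈ atomsOf Sg ++ q.2, a.1 < N) (hfull : ∀ τ ∈ Sg, FullTGD τ)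
    (hDJ : dbInst D ⊆ J) (hJ : satAll J Sg) :
    satAll (liftInst N (constList Sg) D J) (rules N Sg q) := by
  intro τ hτ
  simp only [rules, List.mem_append, List.mem_singleton, List.mem_map, List.mem_flatMap,
    List.mem_range] at hτ
  rcases hτ with ((rfl | ⟨a, ha, rfl⟩) | ⟨σ, hσ, h, hh, rfl⟩) | ⟨a, -, k, -, c, hc, rfl⟩ <;>
    refine satTGD_of_forall fun ν hν => ?_
  · simp only [constRule, List.mem_singleton, forall_eq]
    exact .inr (.inl (by simp [applyA, constAtom, applyT]))
  · simp only [copyRule, List.mem_singleton, forall_eq, applyA_tagAtom] at hν ⊢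
    rw [mem_liftInst_tag hD (by simp)]
    have hb := hDJ (mem_dbInst_of_mem_liftInst (hN a (List.mem_append.2 ha)) hν)
    refine ⟨rfl, by simp [varTuple], ?_⟩
    rwa [List.take_of_length_le (by simp [varTuple])]
  · simp only [encRule, mainRule, List.map_cons, List.map_nil, List.mem_cons, List.not_mem_nil,
      forall_eq_or_imp, false_imp_iff, implies_true, and_true, applyA_encA_constAtom,
      applyA_encA_tagAtom] at hν ⊢
    obtain ⟨hK, hb⟩ := hν
    have hK := eq_of_mem_liftInst_const hD hK
    have hcst : ∀ t ∈ termsOf (atomsOf Sg),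
        applyT ν (encT t) = applyT (fun v => ν (2 * v + 1)) t := by
      rintro (c | v) ht
      · exact List.map_inj_left.1 hK c (mem_constList_of_mem ht)
      · rfl
    have hat : ∀ a : RAtom QTerm, a ∈ σ.1 ∨ a ∈ σ.2 → (a.2.map fun t => applyT ν (encT t)) =
        (applyA (fun v => ν (2 * v + 1)) a).2 := fun a ha =>
      List.map_congr_left fun t ht => hcst t (mem_termsOf (mem_atomsOf hσ ha) ht)
    have hJh := satAll.apply_of_full hJ hfull hσ (ν := fun v => ν (2 * v + 1))
      (fun a ha => by
        have h1 := hb (encA (tagOf N (constList Sg) a))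
          (List.mem_map_of_mem (List.mem_map_of_mem ha))
        rw [tagOf, applyA_encA_tagAtom, mem_liftInst_tag hD (by simp), hat a (.inl ha),
          List.take_of_length_le (by simp [applyA])] at h1
        exact h1.2.2) h hh
    rw [mem_liftInst_tag hD (by simp), List.map_append, hat h (.inr hh)]
    refine ⟨hK, by simp [applyA], ?_⟩
    rwa [List.take_left' (by simp [applyA])]
  · simp only [encRule, dropRule, List.map_cons, List.map_nil, List.mem_singleton, forall_eq,
      applyA_encA_tagAtom, List.map_append] at hν ⊢
    rw [mem_liftInst_tag hD (by simp)] at hν ⊢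
    refine ⟨hν.1, by simp [varTuple], ?_⟩
    rw [← List.take_append_of_le_length (by simp [varTuple])]
    exact hν.2.2

theorem omqEval_translate_subset {Q : OMQ} (hfull : ∀ τ ∈ Q.2.1, FullTGD τ)
    (hDQ : DBover Q.1 D) : omqEval (translate Q) D ⊆ omqEval Q D := by
  intro c hc J hDJ hJ
  have hD := names_lt_freshName.1 D hDQ
  obtain ⟨ν, hν, e⟩ := hc (liftInst (freshName Q) (constList Q.2.1) D J) (fun _ => .inl)
    (satAll_liftInst hD names_lt_freshName.2 hfull hDJ hJ)
  refine ⟨ν, fun a ha => ?_, e⟩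
  have h1 := hν _ (List.mem_map_of_mem ha)
  rw [tagOf, applyA_tagAtom, mem_liftInst_tag hD (by simp),
    List.take_of_length_le (by simp)] at h1
  exact h1.2.2

end Soundness

/-! #### Completeness -/

/-- The model of the original tgds induced by a model `I` of the translated ones. -/
def lowerInst (N : ℕ) (C : List ℕ) (D : Database) (I : Inst) : Inst :=
  dbInst D ∪ {a | (∀ t ∈ a.2, t ∈ C.map Sum.inl) ∧
    (N + 1 + Nat.pair a.1 a.2.length, C.map Sum.inl ++ a.2) ∈ I}

section Completeness

variable {N : ℕ} {D : Database} {I : Inst} {Sg : List TGD} {q : CQ}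

theorem mem_of_append_consts (hfull : ∀ τ ∈ Sg, FullTGD τ) (hI : satAll I (rules N Sg q))
    {a : RAtom QTerm} (ha : a ∈ atomsOf Sg) {x : List GTerm} (hx : x.length = a.2.length)
    (w : List GTerm) (hw : ∀ t ∈ w, t ∈ (constList Sg).map Sum.inl)
    (hlen : w.length ≤ (termsOf (atomsOf Sg)).length)
    (h : (N + 1 + Nat.pair a.1 a.2.length, (constList Sg).map Sum.inl ++ (x ++ w)) ∈ I) :
    (N + 1 + Nat.pair a.1 a.2.length, (constList Sg).map Sum.inl ++ x) ∈ I := by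
  induction w using List.reverseRecOn with
  | nil => simpa using h
  | append_singleton w t ih =>
    simp only [List.length_append, List.length_singleton] at hlen
    refine ih (fun s hs => hw s (List.mem_append_left _ hs)) (by omega) ?_
    obtain ⟨c, hc, rfl⟩ := List.mem_map.1 (hw t (by simp))
    have hmem : encRule (dropRule N (constList Sg) a w.length c) ∈ rules N Sg q := by
      simp only [rules, List.mem_append, List.mem_map, List.mem_flatMap, List.mem_range]
      exact .inr ⟨a, ha, w.length, by omega, c, hc, rfl⟩
    have hv : (varTuple (a.2.length + w.length)).map
        (applyT fun i => ((x ++ w)[i]?).getD (Sum.inl 0)) = x ++ w := by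
      refine List.ext_getElem (by simp [varTuple, hx]) fun i h1 h2 => ?_
      simp [varTuple, applyT, List.getElem?_eq_getElem h2]
    have key := satAll.apply_of_full hI (fullTGD_rules hfull) hmem
      (ν := encAssign fun i => ((x ++ w)[i]?).getD (Sum.inl 0))
    simp only [encRule, dropRule, List.map_cons, List.map_nil, List.mem_singleton, forall_eq,
      applyA_encAssign, applyA_tagAtom, List.map_append, hv] at key
    exact key (by simpa [applyT] using h)

theorem mem_of_mem_lowerInst (hI : satAll I (rules N Sg q)) (hfull : ∀ τ ∈ Sg, FullTGD τ)
    (hDI : dbInst D ⊆ I) {a : RAtom QTerm} (ha : a ∈ atomsOf Sg ++ q.2) {x : List GTerm}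
    (hx : x.length = a.2.length) (h : (a.1, x) ∈ lowerInst N (constList Sg) D I) :
    (N + 1 + Nat.pair a.1 a.2.length, (constList Sg).map Sum.inl ++ x) ∈ I := by
  rcases h with h | h
  · have hmem : copyRule N (constList Sg) a ∈ rules N Sg q := by
      simp only [rules, List.append_assoc, List.mem_append]
      exact .inr (.inl (List.mem_map_of_mem ha))
    have hv : (varTuple a.2.length).map (applyT fun i => (x[i]?).getD (Sum.inl 0)) = x := by
      refine List.ext_getElem (by simp [varTuple, hx]) fun i h1 h2 => ?_
      simp [varTuple, applyT, List.getElem?_eq_getElem h2]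
    have key := satAll.apply_of_full hI (fullTGD_rules hfull) hmem
      (ν := fun i => (x[i]?).getD (Sum.inl 0))
    simp only [copyRule, List.mem_singleton, forall_eq, applyA_tagAtom, hv] at key
    refine key ?_
    rw [applyA, hv]
    exact hDI h
  · exact hx ▸ h.2

theorem args_of_mem_lowerInst (hD : ∀ f ∈ D, ∀ c ∈ f.2, c = 0 ∨ c = 1) {a : RAtom GTerm}
    (h : a ∈ lowerInst N (constList Sg) D I) :
    ∀ t ∈ a.2, t ∈ (constList Sg).map (Sum.inl : ℕ → GTerm) := by
  rcases h with ⟨f, hf, rfl⟩ | h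
  · intro t ht
    obtain ⟨c, hc, rfl⟩ := List.mem_map.1 ht
    refine List.mem_map_of_mem ?_
    rcases hD f hf c hc with rfl | rfl <;> simp [constList]
  · exact h.1

theorem satAll_lowerInst (hfull : ∀ τ ∈ Sg, FullTGD τ)
    (hD : ∀ f ∈ D, ∀ c ∈ f.2, c = 0 ∨ c = 1) (hDI : dbInst D ⊆ I)
    (hI : satAll I (rules N Sg q)) : satAll (lowerInst N (constList Sg) D I) Sg := by
  refine fun σ hσ => satTGD_of_forall fun ν hν h hh => ?_
  have hargs : ∀ t ∈ termsOf σ.1, applyT ν t ∈ (constList Sg).map (Sum.inl : ℕ → GTerm) := by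
    intro t ht
    obtain ⟨a, ha, ht⟩ := List.mem_flatMap.1 ht
    exact args_of_mem_lowerInst hD (hν a ha) _ (List.mem_map_of_mem ht)
  have hhead : ∀ t ∈ h.2.map (applyT ν), t ∈ (constList Sg).map (Sum.inl : ℕ → GTerm) := by
    intro t ht
    obtain ⟨s, hs, rfl⟩ := List.mem_map.1 ht
    rcases s with c | v
    · exact List.mem_map_of_mem (mem_constList_of_mem
        (mem_termsOf (mem_atomsOf hσ (.inr hh)) hs))
    · exact hargs _ (fullTGD_iff.1 (hfull σ hσ) v (mem_termsOf hh hs))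
  have hmem : encRule (mainRule N (constList Sg) σ.1 h) ∈ rules N Sg q := by
    simp only [rules, List.mem_append, List.mem_map, List.mem_flatMap]
    exact .inl (.inr ⟨σ, hσ, h, hh, rfl⟩)
  have hconst : constRule N (constList Sg) ∈ rules N Sg q := by simp [rules]
  have hK := satAll.apply_of_full hI (fullTGD_rules hfull) hconst (ν := ν)
    (by simp [constRule]) (constAtom N (constList Sg)) (by simp [constRule])
  have key := satAll.apply_of_full hI (fullTGD_rules hfull) hmem (ν := encAssign ν)
  simp only [encRule, mainRule, List.map_cons, List.map_nil, List.mem_cons, List.not_mem_nil,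
    forall_eq_or_imp, false_imp_iff, implies_true, and_true, List.map_map, List.forall_mem_map,
    Function.comp_apply, applyA_encAssign, tagOf, applyA_tagAtom, List.map_append] at key
  have key := key ⟨hK, fun a ha => mem_of_mem_lowerInst hI hfull hDI
    (List.mem_append_left _ (mem_atomsOf hσ (.inl ha))) (by simp) (hν a ha)⟩
  refine .inr ⟨hhead, ?_⟩
  have hle : (termsOf σ.1).length ≤ (termsOf (atomsOf Sg)).length := by
    have : (σ.1 ++ σ.2).Sublist (atomsOf Sg) :=
      List.sublist_flatten_of_mem (List.mem_map_of_mem hσ)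
    exact (((List.sublist_append_left _ _).trans this).flatMap Prod.snd).length_le
  have := mem_of_append_consts hfull hI (mem_atomsOf hσ (.inr hh)) (by simp) _
    (List.forall_mem_map.2 hargs) (by simpa using hle) key
  simpa [applyA] using this

theorem omqEval_subset_translate {Q : OMQ} (hfull : ∀ τ ∈ Q.2.1, FullTGD τ)
    (hD : ∀ f ∈ D, ∀ c ∈ f.2, c = 0 ∨ c = 1) : omqEval Q D ⊆ omqEval (translate Q) D := by
  intro c hc I hDI hI
  obtain ⟨ν, hν, e⟩ := hc (lowerInst (freshName Q) (constList Q.2.1) D I)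
    Set.subset_union_left (satAll_lowerInst hfull hD hDI hI)
  refine ⟨ν, fun a ha => ?_, e⟩
  obtain ⟨b, hb, rfl⟩ := List.mem_map.1 ha
  rw [tagOf, applyA_tagAtom]
  exact mem_of_mem_lowerInst hI hfull hDI (List.mem_append_right _ hb) (by simp) (hν b hb)

end Completeness

/-! #### Equivalence -/

theorem db01_subset (D : Database) : db01 D ⊆ D := List.filter_subset_self _

theorem omqEval_translate {Q : OMQ} (hfull : ∀ τ ∈ Q.2.1, FullTGD τ) (h01 : ZeroOne Q)
    {D : Database} (hD : DBover Q.1 D) : omqEval (translate Q) D = omqEval Q D := by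
  refine (omqEval_translate_subset hfull hD).antisymm ?_
  rw [h01 D hD]
  refine (omqEval_subset_translate hfull fun f hf c hc => ?_).trans (certAns_mono (db01_subset D))
  simpa using List.all_eq_true.1 (List.mem_filter.1 hf).2 c hc

theorem zeroOne_translate {Q : OMQ} (hfull : ∀ τ ∈ Q.2.1, FullTGD τ) (h01 : ZeroOne Q) :
    ZeroOne (translate Q) := by
  intro D hD
  have hD' : DBover Q.1 (db01 D) := fun f hf => hD f (db01_subset D hf)
  rw [omqEval_translate hfull h01 hD, omqEval_translate hfull h01 hD', h01 D hD]

end LosslessOMQ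

/-- full 0-1 OMQs can be made sticky.
Every 0-1 OMQ `Q = (S, Σ, q)` with `Σ` a finite set of full tgds can be
transformed in polynomial time (formalized: by a computable translation with
polynomially bounded output size) into an equivalent 0-1 OMQ
`Q' = (S, Σ', q')` where `Σ'` is sticky — indeed lossless. -/
theorem statement_19 :
    ∃ F : OMQ → OMQ, Computable F ∧
      (∃ c k : ℕ, ∀ Q : OMQ, omqSize (F Q) ≤ c * (omqSize Q + 1) ^ k) ∧
      ∀ Q : OMQ, (∀ τ ∈ Q.2.1, FullTGD τ) → ZeroOne Q →
        (F Q).1 = Q.1 ∧ Sticky (F Q).2.1 ∧ (∀ τ ∈ (F Q).2.1, LosslessTGD τ) ∧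
        ZeroOne (F Q) ∧
        ∀ D : Database, DBover Q.1 D → omqEval (F Q) D = omqEval Q D := by
  refine ⟨LosslessOMQ.translate, LosslessOMQ.primrec_translate.to_comp,
    ⟨90, 5, LosslessOMQ.omqSize_translate_le⟩, fun Q hfull h01 => ?_⟩
  have hs := LosslessOMQ.strictlyLossless_rules (LosslessOMQ.freshName Q) Q.2.1 Q.2.2
  exact ⟨rfl, LosslessOMQ.sticky_of_strictlyLossless hs, fun τ hτ => (hs τ hτ).lossless,
    LosslessOMQ.zeroOne_translate hfull h01,
    fun D hD => LosslessOMQ.omqEval_translate hfull h01 hD⟩
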